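/- arXiv:2105.00608 — 2 statements merged into one kernel-verified Lean document; each statement's English description precedes it below -/
import Mathlib

section
/- Let (X_t)_{t≥0} be a jointly measurable real-valued stochastic process on a probability space (Ω, 𝓕, P). Then for every x ≥ 1, P( λ({t ≥ 0 : X_t ≤ 0}) ≥ x ) ≤ ∫_{x−1}^∞ P(X_t ≤ 0) dt, where λ denotes Lebesgue measure on [0,∞). -/
open MeasureTheory Set

/-- A measurable set whose part in `[0, ∞)` has measure at least `x ≥ 1` meets `(x - 1, ∞)` in a
set of measure at least `1`. -/
theorem one_le_volume_restrict_Ioi_of_le {x : ℝ} (hx : 1 ≤ x) {A : Set ℝ} (hA : MeasurableSet A)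
    (h : ENNReal.ofReal x ≤ volume {t : ℝ | 0 ≤ t ∧ t ∈ A}) :
    1 ≤ volume.restrict (Ioi (x - 1)) A := by
  rw [Measure.restrict_apply hA]
  have hsub : {t : ℝ | 0 ≤ t ∧ t ∈ A} ⊆ Icc 0 (x - 1) ∪ A ∩ Ioi (x - 1) := fun t ht =>
    (le_or_gt t (x - 1)).imp (fun h => ⟨ht.1, h⟩) fun h => ⟨ht.2, h⟩
  have hle : ENNReal.ofReal (x - 1) + 1 ≤ ENNReal.ofReal (x - 1) + volume (A ∩ Ioi (x - 1)) :=
    calc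
      ENNReal.ofReal (x - 1) + 1 = ENNReal.ofReal x := by
        rw [← ENNReal.ofReal_one, ← ENNReal.ofReal_add (sub_nonneg.2 hx) zero_le_one,
          sub_add_cancel]
      _ ≤ volume (Icc 0 (x - 1)) + volume (A ∩ Ioi (x - 1)) :=
        h.trans ((measure_mono hsub).trans (measure_union_le _ _))
      _ = ENNReal.ofReal (x - 1) + volume (A ∩ Ioi (x - 1)) := by
        rw [Real.volume_Icc, sub_zero]
  exact (ENNReal.add_le_add_iff_left ENNReal.ofReal_ne_top).1 hle

/-- The occupation-time bound concluding the proof of Lemma 5.2: if the Lebesgue measure of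
`{t ≥ 0 : X_t ≤ 0}` is at least `x ≥ 1`, then this set must intersect `[x-1, ∞)` in a set of
measure at least `1`, and one concludes by Markov's inequality and Fubini's theorem. -/
theorem lifo_occupation_time_bound
    {Ω : Type*} [MeasurableSpace Ω] (P : Measure Ω) [IsProbabilityMeasure P]
    (X : ℝ → Ω → ℝ) (hX : Measurable fun p : ℝ × Ω => X p.1 p.2) :
    ∀ x : ℝ, 1 ≤ x →
      P {ω | ENNReal.ofReal x ≤ volume {t : ℝ | 0 ≤ t ∧ X t ω ≤ 0}} ≤
        ∫⁻ t in Set.Ioi (x - 1), P {ω | X t ω ≤ 0} := by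
  intro x hx
  have hS : MeasurableSet {p : ℝ × Ω | X p.1 p.2 ≤ 0} := measurableSet_le hX measurable_const
  calc
    P {ω | ENNReal.ofReal x ≤ volume {t : ℝ | 0 ≤ t ∧ X t ω ≤ 0}}
      ≤ P {ω | 1 ≤ volume.restrict (Ioi (x - 1)) {t | X t ω ≤ 0}} := by
        refine measure_mono fun ω hω => ?_
        exact one_le_volume_restrict_Ioi_of_le hx (hS.preimage measurable_prodMk_right) hω
    _ ≤ ∫⁻ ω, volume.restrict (Ioi (x - 1)) {t | X t ω ≤ 0} ∂P := by
        simpa using mul_meas_ge_le_lintegral (μ := P)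
          (measurable_measure_prodMk_right (μ := volume.restrict (Ioi (x - 1))) hS) 1
    _ = ∫⁻ t in Ioi (x - 1), P {ω | X t ω ≤ 0} :=
        (Measure.prod_apply_symm hS).symm.trans (Measure.prod_apply hS)
end

section
/- For every ε ∈ (0,1) there exists M₀ > 1 such that for every M ≥ M₀ there exist β ∈ (1−ε, 1+ε) and γ ∈ (1−ε, 1) for which the measure ν_{M,β,γ} is a probability measure on [0,∞) whose mean satisfies ∫_{[0,∞)} t ν_{M,β,γ}(dt) = 1. -/
open MeasureTheory Real

/-- The interarrival-time distribution (1.1) of the paper: an atom of mass `1 - 1/M` at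
`1/M²` together with the density `t ↦ (1/M)e^{-β(t-γM)}` on the interval `[γM, 2M]`. -/
noncomputable def nuMeasure (M β γ : ℝ) : Measure ℝ :=
  ENNReal.ofReal (1 - 1 / M) • Measure.dirac (1 / M ^ 2) +
    volume.withDensity fun t =>
      ENNReal.ofReal
        ((Set.Icc (γ * M) (2 * M)).indicator
          (fun s => (1 / M) * Real.exp (-β * (s - γ * M))) t)

lemma integral_exp_neg_mul_shift {β : ℝ} (hβ : β ≠ 0) (a b : ℝ) :
    ∫ s in a..b, Real.exp (-β * (s - a)) = (1 - Real.exp (-β * (b - a))) / β := by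
  have h : ∀ s ∈ Set.uIcc a b,
      HasDerivAt (fun s => -(Real.exp (-β * (s - a)) / β)) (Real.exp (-β * (s - a))) s := by
    intro s _
    have h := (((((hasDerivAt_id s).sub_const a).const_mul (-β)).exp).div_const β).neg
    refine h.congr_deriv ?_
    simp only [id]
    field_simp
  rw [intervalIntegral.integral_eq_sub_of_hasDerivAt h
    (Continuous.intervalIntegrable (by fun_prop) _ _)]
  simp
  field_simp
  ring

lemma integral_mul_exp_neg_mul_shift {β : ℝ} (hβ : β ≠ 0) (a b : ℝ) :
    ∫ s in a..b, Real.exp (-β * (s - a)) * s =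
      (a / β + 1 / β ^ 2) - Real.exp (-β * (b - a)) * (b / β + 1 / β ^ 2) := by
  have h : ∀ s ∈ Set.uIcc a b,
      HasDerivAt (fun s => -(Real.exp (-β * (s - a)) * (s / β + 1 / β ^ 2)))
        (Real.exp (-β * (s - a)) * s) s := by
    intro s _
    have h := (((((hasDerivAt_id s).sub_const a).const_mul (-β)).exp).mul
      (((hasDerivAt_id s).div_const β).add_const (1 / β ^ 2))).neg
    refine h.congr_deriv ?_
    simp only [id]
    field_simp
    ring
  rw [intervalIntegral.integral_eq_sub_of_hasDerivAt h
    (Continuous.intervalIntegrable (by fun_prop) _ _)]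
  simp
  ring

lemma nuMeasure_univ {M β γ : ℝ} (hM : 1 ≤ M) (hβ : β ≠ 0) (hγ : γ ≤ 2) :
    nuMeasure M β γ Set.univ = ENNReal.ofReal
      (1 - 1 / M + 1 / M * ((1 - Real.exp (-β * (2 * M - γ * M))) / β)) := by
  have hM0 : 0 < M := by linarith
  have hle : γ * M ≤ 2 * M := by gcongr
  have hint : Integrable ((Set.Icc (γ * M) (2 * M)).indicator
      (fun s => (1 / M) * Real.exp (-β * (s - γ * M)))) :=
    (Continuous.integrableOn_Icc (by fun_prop)).integrable_indicator measurableSet_Icc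
  have hnn : ∀ t, 0 ≤ (Set.Icc (γ * M) (2 * M)).indicator
      (fun s => (1 / M) * Real.exp (-β * (s - γ * M))) t :=
    fun t => Set.indicator_nonneg (fun s _ => by positivity) t
  have hval : ∫ t, (Set.Icc (γ * M) (2 * M)).indicator
      (fun s => (1 / M) * Real.exp (-β * (s - γ * M))) t =
      1 / M * ((1 - Real.exp (-β * (2 * M - γ * M))) / β) := by
    rw [integral_indicator measurableSet_Icc, integral_Icc_eq_integral_Ioc,
      ← intervalIntegral.integral_of_le hle, intervalIntegral.integral_const_mul,
      integral_exp_neg_mul_shift hβ]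
  have hatom : 0 ≤ 1 - 1 / M := by
    rw [sub_nonneg, div_le_one hM0]; exact hM
  rw [nuMeasure, Measure.add_apply, withDensity_apply _ MeasurableSet.univ, Measure.restrict_univ,
    ← ofReal_integral_eq_lintegral_ofReal hint (Filter.Eventually.of_forall hnn), hval,
    ENNReal.ofReal_add hatom (hval ▸ integral_nonneg hnn)]
  simp

lemma integral_id_nuMeasure {M β γ : ℝ} (hM : 1 ≤ M) (hβ : β ≠ 0) (hγ : γ ≤ 2) :
    ∫ t, t ∂(nuMeasure M β γ) = (1 - 1 / M) * (1 / M ^ 2) +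
      1 / M * ((γ * M / β + 1 / β ^ 2) -
        Real.exp (-β * (2 * M - γ * M)) * (2 * M / β + 1 / β ^ 2)) := by
  have hM0 : 0 < M := by linarith
  have hle : γ * M ≤ 2 * M := by gcongr
  have hnn : ∀ t, 0 ≤ (Set.Icc (γ * M) (2 * M)).indicator
      (fun s => (1 / M) * Real.exp (-β * (s - γ * M))) t :=
    fun t => Set.indicator_nonneg (fun s _ => by positivity) t
  have hmeas : Measurable fun t => ENNReal.ofReal ((Set.Icc (γ * M) (2 * M)).indicator
      (fun s => (1 / M) * Real.exp (-β * (s - γ * M))) t) :=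
    ENNReal.measurable_ofReal.comp
      (Measurable.indicator (by fun_prop) measurableSet_Icc)
  have hatom : 0 ≤ 1 - 1 / M := by
    rw [sub_nonneg, div_le_one hM0]; exact hM
  have hfun : (fun t : ℝ => (ENNReal.ofReal ((Set.Icc (γ * M) (2 * M)).indicator
      (fun s => (1 / M) * Real.exp (-β * (s - γ * M))) t)).toReal • t) =
      (Set.Icc (γ * M) (2 * M)).indicator
        (fun s => (1 / M) * (Real.exp (-β * (s - γ * M)) * s)) := by
    funext t
    rw [ENNReal.toReal_ofReal (hnn t)]
    by_cases ht : t ∈ Set.Icc (γ * M) (2 * M)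
    · simp only [Set.indicator_of_mem ht, smul_eq_mul]; ring
    · simp only [Set.indicator_of_notMem ht, zero_smul]
  have hfin : ∀ᵐ t : ℝ, ENNReal.ofReal ((Set.Icc (γ * M) (2 * M)).indicator
      (fun s => (1 / M) * Real.exp (-β * (s - γ * M))) t) < ⊤ :=
    Filter.Eventually.of_forall fun t => ENNReal.ofReal_lt_top
  rw [nuMeasure, integral_add_measure]
  · rw [integral_smul_measure, integral_dirac,
      integral_withDensity_eq_integral_toReal_smul hmeas hfin, hfun,
      integral_indicator measurableSet_Icc, integral_Icc_eq_integral_Ioc,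
      ← intervalIntegral.integral_of_le hle, intervalIntegral.integral_const_mul,
      integral_mul_exp_neg_mul_shift hβ, ENNReal.toReal_ofReal hatom, smul_eq_mul]
  · exact (integrable_dirac (by simp)).smul_measure ENNReal.ofReal_ne_top
  · rw [integrable_withDensity_iff_integrable_smul' hmeas hfin, hfun]
    exact (Continuous.integrableOn_Icc (by fun_prop)).integrable_indicator measurableSet_Icc

lemma exp_neg_le_two_div_sq {y : ℝ} (hy : 0 < y) : Real.exp (-y) ≤ 2 / y ^ 2 := by
  rw [Real.exp_neg, inv_le_comm₀ (Real.exp_pos y) (by positivity), inv_div]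
  linarith [Real.quadratic_le_exp_of_nonneg hy.le]

lemma exists_sub_one_add_exp_neg_eq {c : ℝ} (hc : 10 ≤ c) :
    ∃ x, c / 2 ≤ x ∧ x - (1 - Real.exp (-x)) = c * (1 - Real.exp (-x)) ^ 2 := by
  have hcont : ContinuousOn
      (fun x => x - (1 - Real.exp (-x)) - c * (1 - Real.exp (-x)) ^ 2)
      (Set.Icc (c / 2) (c + 1)) := by fun_prop
  have hlow : Real.exp (-(c / 2)) ≤ 2 / 25 := by
    refine (exp_neg_le_two_div_sq (by linarith)).trans ?_
    gcongr
    nlinarith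
  have hpos := Real.exp_pos (-(c / 2))
  have hpos' := Real.exp_pos (-(c + 1))
  have hle' : Real.exp (-(c + 1)) ≤ 1 := Real.exp_le_one_iff.2 (by linarith)
  have hmem : (0 : ℝ) ∈ Set.Icc
      ((fun x => x - (1 - Real.exp (-x)) - c * (1 - Real.exp (-x)) ^ 2) (c / 2))
      ((fun x => x - (1 - Real.exp (-x)) - c * (1 - Real.exp (-x)) ^ 2) (c + 1)) := by
    constructor
    · have h : (1 / 2 : ℝ) ≤ (1 - Real.exp (-(c / 2))) ^ 2 := by nlinarith
      have h2 := mul_le_mul_of_nonneg_left h (by linarith : 0 ≤ c)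
      dsimp only
      linarith
    · have h : (1 - Real.exp (-(c + 1))) ^ 2 ≤ 1 := by nlinarith
      have h2 := mul_le_mul_of_nonneg_left h (by linarith : 0 ≤ c)
      dsimp only
      linarith
  obtain ⟨x, hx, hx0⟩ := intermediate_value_Icc (by linarith) hcont hmem
  exact ⟨x, hx.1, by dsimp only at hx0; linarith⟩

/-- For every `ε ∈ (0,1)` and all sufficiently large `M`, the parameters `β` and `γ` can be
chosen within `ε` of `1` (with `γ < 1`) so that `ν_{M,β,γ}` is a probability measure with
mean `1`. -/
theorem lifo_nu_probability_mean_one :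
    ∀ ε ∈ Set.Ioo (0 : ℝ) 1, ∃ M₀ : ℝ, 1 < M₀ ∧
      ∀ M : ℝ, M₀ ≤ M →
        ∃ β ∈ Set.Ioo (1 - ε) (1 + ε), ∃ γ ∈ Set.Ioo (1 - ε) 1,
          IsProbabilityMeasure (nuMeasure M β γ) ∧
            ∫ t, t ∂(nuMeasure M β γ) = 1 := by
  rintro ε ⟨hε0, hε1⟩
  have hM₀ : 10 ≤ 10 / ε := by rw [le_div_iff₀ hε0]; linarith
  refine ⟨10 / ε, by linarith, fun M hM => ?_⟩
  have hM10 : 10 ≤ M := hM₀.trans hM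
  have hM0 : 0 < M := by linarith
  have hεM : 10 * (1 / M) ≤ ε := by
    rw [div_le_iff₀ hε0] at hM
    rw [mul_one_div, div_le_iff₀ hM0]; linarith
  obtain ⟨r, hr⟩ : ∃ r, r = 1 / M := ⟨_, rfl⟩
  have hr0 : 0 < r := by rw [hr]; positivity
  have hrM : r * M = 1 := by rw [hr]; field_simp
  have hr10 : r ≤ 1 / 10 := by rw [hr]; gcongr
  rw [← hr] at hεM
  have hr2 : r ^ 2 ≤ r / 10 := by nlinarith
  have hr3 : 0 < r ^ 3 := by positivity
  have hr32 : r ^ 3 ≤ r ^ 2 := by nlinarith [sq_nonneg r]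
  obtain ⟨c, hc⟩ : ∃ c, c = M + r - r ^ 2 := ⟨_, rfl⟩
  have hcM : M ≤ c := by linarith
  obtain ⟨x, hxc, hx⟩ := exists_sub_one_add_exp_neg_eq (hM10.trans hcM)
  have hu : Real.exp (-x) ≤ 8 * r ^ 2 := by
    calc Real.exp (-x) ≤ Real.exp (-(M / 2)) := by gcongr; linarith
      _ ≤ 2 / (M / 2) ^ 2 := exp_neg_le_two_div_sq (by linarith)
      _ = 8 * r ^ 2 := by rw [hr]; field_simp; norm_num
  have hu0 := Real.exp_pos (-x)
  obtain ⟨β, hβ⟩ : ∃ β, β = 1 - Real.exp (-x) := ⟨_, rfl⟩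
  rw [← hβ] at hx
  have hβ0 : 0 < β := by linarith
  have hβ1 : β < 1 := by linarith
  have hcr : c * r = 1 + r ^ 2 - r ^ 3 := by
    rw [hc]; linear_combination hrM
  obtain ⟨γ, hγ⟩ : ∃ γ, γ = 2 - (1 + c * β) * r := ⟨_, rfl⟩
  have hγ' : γ = 2 - r - β * (1 + r ^ 2 - r ^ 3) := by
    rw [hγ]; linear_combination -β * hcr
  have hγ1 : γ < 1 := by
    have : 0 ≤ β * (r ^ 2 - r ^ 3) := mul_nonneg hβ0.le (by linarith)
    linarith
  have hγε : 1 - ε < γ := by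
    have : β * (1 + r ^ 2 - r ^ 3) ≤ 1 * (1 + r ^ 2 - r ^ 3) := by
      gcongr
      linarith
    linarith
  have hlen : 2 * M - γ * M = 1 + c * β := by
    rw [hγ]; linear_combination (1 + c * β) * hrM
  have hexp : Real.exp (-β * (2 * M - γ * M)) = 1 - β := by
    rw [hlen, show -β * (1 + c * β) = -x by linear_combination hx, hβ]; ring
  refine ⟨β, ⟨by linarith, by linarith⟩, γ, ⟨hγε, hγ1⟩, ⟨?_⟩, ?_⟩
  · rw [nuMeasure_univ (by linarith) hβ0.ne' (by linarith), hexp, sub_sub_cancel,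
      div_self hβ0.ne', mul_one, sub_add_cancel, ENNReal.ofReal_one]
  · rw [integral_id_nuMeasure (by linarith) hβ0.ne' (by linarith), hexp]
    have hγM : γ * M = 2 * M - (1 + c * β) := by linarith
    rw [hγM, hc, hr]
    field_simp
    ring
end
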